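/- Let n = 4 and let T ≥ 1. Suppose P_0, …, P_{T−1} ∈ 𝓜_4 satisfy: each P_k ≠ I_4, P_k ≠ P_{k+1} for 0 ≤ k ≤ T−2, P_{T−1}⋯P_0 = (1/4)·1·1^T, and P_{T−2}⋯P_0 ≠ (1/4)·1·1^T. Then T ≥ 4 and there exists a permutation (a,b,c,d) of (1,2,3,4) such that P_{T−1} = M_{ab}, P_{T−2} = M_{cd}, P_{T−3} = M_{ac}, and P_{T−4} = M_{bd}. -/

import Mathlib

open Matrix

/-- The symmetric gossip matrix `M_{ij} = I - (e_i - e_j)(e_i - e_j)^T / 2`. -/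
noncomputable def gossipM (n : ℕ) (i j : Fin n) : Matrix (Fin n) (Fin n) ℝ :=
  1 - (1 / 2 : ℝ) • vecMulVec (Pi.single i 1 - Pi.single j 1) (Pi.single i 1 - Pi.single j 1)

/-- The four indices are pairwise distinct. -/
def Dist4 (a b c d : Fin 4) : Prop :=
  a ≠ b ∧ a ≠ c ∧ a ≠ d ∧ b ≠ c ∧ b ≠ d ∧ c ≠ d

instance (a b c d : Fin 4) : Decidable (Dist4 a b c d) := by
  unfold Dist4; infer_instance

theorem dist4_cover : ∀ a b c d : Fin 4, Dist4 a b c d →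
    ∀ e, e = a ∨ e = b ∨ e = c ∨ e = d := by decide +kernel

theorem dist4_exists : ∀ a b : Fin 4, a ≠ b → ∃ c d, Dist4 a b c d := by decide +kernel

theorem dist4_sum (z : Fin 4 → ℤ) (a b c d : Fin 4) (h : Dist4 a b c d) :
    ∑ i, z i = z a + z b + z c + z d := by
  have hu : (Finset.univ : Finset (Fin 4)) = {a, b, c, d} := by
    ext e
    simpa using dist4_cover a b c d h e
  obtain ⟨h1, h2, h3, h4, h5, h6⟩ := h
  rw [hu, Finset.sum_insert (by simp [*]), Finset.sum_insert (by simp [*]),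
    Finset.sum_insert (by simp [*]), Finset.sum_singleton]
  ring

theorem dist4_perm (a b c d : Fin 4) (h : Dist4 a b c d) :
    ∃ σ : Equiv.Perm (Fin 4), σ 0 = a ∧ σ 1 = b ∧ σ 2 = c ∧ σ 3 = d := by
  have hinj : Function.Injective ![a, b, c, d] := by
    obtain ⟨h1, h2, h3, h4, h5, h6⟩ := h
    intro i j hij
    fin_cases i <;> fin_cases j <;> simp_all
  exact ⟨Equiv.ofBijective _ (Finite.injective_iff_bijective.mp hinj), rfl, rfl, rfl, rfl⟩

theorem gossip_symm (i j : Fin 4) : gossipM 4 i j = gossipM 4 j i := by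
  unfold gossipM
  ext p q
  simp [vecMulVec_apply]
  ring

theorem gossip_self (i : Fin 4) : gossipM 4 i i = 1 := by
  unfold gossipM
  simp

theorem gossip_mul (i j : Fin 4) (A : Matrix (Fin 4) (Fin 4) ℝ) (p c : Fin 4) :
    (gossipM 4 i j * A) p c =
      A p c - (1 / 2) * ((Pi.single i 1 - Pi.single j 1 : Fin 4 → ℝ) p) * (A i c - A j c) := by
  unfold gossipM
  rw [sub_mul, one_mul, Matrix.smul_mul, Matrix.sub_apply, Matrix.smul_apply,
    vecMulVec_mul, vecMulVec_apply, sub_vecMul]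
  simp
  ring

theorem gossip_left (i j : Fin 4) (hij : i ≠ j) (A : Matrix (Fin 4) (Fin 4) ℝ) (c : Fin 4) :
    (gossipM 4 i j * A) i c = (A i c + A j c) / 2 := by
  rw [gossip_mul]; simp [hij]; ring

theorem gossip_right (i j : Fin 4) (hij : i ≠ j) (A : Matrix (Fin 4) (Fin 4) ℝ) (c : Fin 4) :
    (gossipM 4 i j * A) j c = (A i c + A j c) / 2 := by
  rw [gossip_mul]; simp [hij.symm]; ring

theorem gossip_other (i j p : Fin 4) (hi : p ≠ i) (hj : p ≠ j)
    (A : Matrix (Fin 4) (Fin 4) ℝ) (c : Fin 4) :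
    (gossipM 4 i j * A) p c = A p c := by
  rw [gossip_mul]; simp [hi, hj]

/-- All rows lie on a line, at integer positions with odd sum. -/
def Good (A : Matrix (Fin 4) (Fin 4) ℝ) : Prop :=
  ∃ (r w : Fin 4 → ℝ) (z : Fin 4 → ℤ), w ≠ 0 ∧ (∀ i c, A i c = r c + z i * w c) ∧ Odd (∑ i, z i)

theorem good_of_line (p q k l : Fin 4) (h : Dist4 p q k l) (A B : Matrix (Fin 4) (Fin 4) ℝ)
    (hB : B = gossipM 4 p q * A) (r w : Fin 4 → ℝ) (z : Fin 4 → ℤ) (hw : w ≠ 0)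
    (hz : ∀ i c, B i c = r c + z i * w c) (ho : Odd (∑ i, z i)) (hpq : z p = z q)
    (s : ℤ) (hs : ∀ c, A p c = r c + s * w c) : Good A := by
  have h' := h
  obtain ⟨h1, h2, h3, h4, h5, h6⟩ := h'
  refine ⟨r, w, Function.update (Function.update z p s) q (2 * z p - s), hw, ?_, ?_⟩
  · intro i c
    rcases dist4_cover p q k l h i with rfl | rfl | rfl | rfl
    · simp [h1, hs]
    · have := gossip_left p i h1 A c
      rw [← hB, hz, hs] at this
      simp
      linarith
    · have := gossip_other p q i h2.symm h4.symm A c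
      rw [← hB, hz] at this
      simp [h2.symm, h4.symm, this]
    · have := gossip_other p q i h3.symm h5.symm A c
      rw [← hB, hz] at this
      simp [h3.symm, h5.symm, this]
  · rw [dist4_sum _ p q k l h] at ho ⊢
    simp [h1, h2.symm, h3.symm, h4.symm, h5.symm]
    rw [← hpq] at ho
    convert ho using 1
    ring

theorem good_pair (p q : Fin 4) (hpq : p ≠ q) (A B : Matrix (Fin 4) (Fin 4) ℝ)
    (hB : B = gossipM 4 p q * A) (r w : Fin 4 → ℝ) (z : Fin 4 → ℤ) (hw : w ≠ 0)
    (hz : ∀ i c, B i c = r c + z i * w c) : z p = z q := by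
  obtain ⟨c, hc⟩ := Function.ne_iff.mp hw
  have h1 := gossip_left p q hpq A c
  have h2 := gossip_right p q hpq A c
  rw [← hB, hz] at h1 h2
  have h3 : ((z p : ℝ) - z q) * w c = 0 := by linarith
  rcases mul_eq_zero.mp h3 with h | h
  · exact_mod_cast sub_eq_zero.mp h
  · exact absurd h hc

theorem good_step (p q : Fin 4) (hpq : p ≠ q) (A : Matrix (Fin 4) (Fin 4) ℝ)
    (hG : Good (gossipM 4 p q * A)) (e f : Fin 4) (hef : e ≠ f) (hA : A e = A f) : Good A := by
  obtain ⟨k, l, hd⟩ := dist4_exists p q hpq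
  have hd' := hd
  obtain ⟨h1, h2, h3, h4, h5, h6⟩ := hd'
  obtain ⟨r, w, z, hw, hz, ho⟩ := hG
  have hzpq := good_pair p q hpq A _ rfl r w z hw hz
  have hk : ∀ c, A k c = r c + z k * w c := fun c => by
    rw [← hz, gossip_other p q k h2.symm h4.symm]
  have hl : ∀ c, A l c = r c + z l * w c := fun c => by
    rw [← hz, gossip_other p q l h3.symm h5.symm]
  have keyp : ∀ s : ℤ, (∀ c, A p c = r c + s * w c) → Good A :=
    fun s hs => good_of_line p q k l hd A _ rfl r w z hw hz ho hzpq s hs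
  have keyq : ∀ s : ℤ, (∀ c, A q c = r c + s * w c) → Good A := by
    intro s hs
    apply keyp (2 * z p - s)
    intro c
    have := gossip_left p q hpq A c
    rw [hz, hs] at this
    push_cast
    linarith
  have keypq : A p = A q → Good A := by
    intro h
    apply keyp (z p)
    intro c
    have := gossip_left p q hpq A c
    rw [hz, ← h] at this
    linarith
  have keykl : A k = A l → Good A := by
    intro h
    exfalso
    obtain ⟨c, hc⟩ := Function.ne_iff.mp hw
    have e1 := congrFun h c
    rw [hk, hl] at e1
    have e2 : ((z k : ℝ) - z l) * w c = 0 := by linarith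
    rcases mul_eq_zero.mp e2 with h | h
    · have : z k = z l := by exact_mod_cast sub_eq_zero.mp h
      rw [dist4_sum _ p q k l hd, hzpq, this] at ho
      obtain ⟨m, hm⟩ := ho
      omega
    · exact absurd h hc
  have pk : A p = A k → Good A := fun h => keyp (z k) fun c => by rw [h, hk]
  have pl : A p = A l → Good A := fun h => keyp (z l) fun c => by rw [h, hl]
  have qk : A q = A k → Good A := fun h => keyq (z k) fun c => by rw [h, hk]
  have ql : A q = A l → Good A := fun h => keyq (z l) fun c => by rw [h, hl]
  rcases dist4_cover p q k l hd e with rfl | rfl | rfl | rfl <;>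
  rcases dist4_cover _ _ _ _ hd f with rfl | rfl | rfl | rfl <;>
  first
    | exact absurd rfl hef
    | exact keypq hA
    | exact keypq hA.symm
    | exact keykl hA
    | exact keykl hA.symm
    | exact pk hA
    | exact pk hA.symm
    | exact pl hA
    | exact pl hA.symm
    | exact qk hA
    | exact qk hA.symm
    | exact ql hA
    | exact ql hA.symm

theorem good_base (p q : Fin 4) (hpq : p ≠ q) : ¬ Good (gossipM 4 p q * 1) := by
  intro hG
  obtain ⟨k, l, hd⟩ := dist4_exists p q hpq
  have hd' := hd
  obtain ⟨h1, h2, h3, h4, h5, h6⟩ := hd'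
  obtain ⟨r, w, z, hw, hz, ho⟩ := hG
  have hpk := gossip_left p q hpq 1 k
  have hpl := gossip_left p q hpq 1 l
  have hkk := gossip_other p q k h2.symm h4.symm 1 k
  have hkl := gossip_other p q k h2.symm h4.symm 1 l
  have hlk := gossip_other p q l h3.symm h5.symm 1 k
  have hll := gossip_other p q l h3.symm h5.symm 1 l
  rw [hz] at hpk hpl hkk hkl hlk hll
  simp [Matrix.one_apply, h2, h3, h4, h5, h6, h6.symm] at hpk hpl hkk hkl hlk hll
  have a1 : ((z k : ℝ) - z p) * w k = 1 := by linarith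
  have a2 : ((z l : ℝ) - z p) * w k = 0 := by linarith
  have a3 : ((z l : ℝ) - z p) * w l = 1 := by linarith
  rcases mul_eq_zero.mp a2 with h | h
  · rw [h] at a3; simp at a3
  · rw [h] at a1; simp at a1

/-- The partial products. -/
noncomputable def QQ (P : ℕ → Matrix (Fin 4) (Fin 4) ℝ) (k : ℕ) : Matrix (Fin 4) (Fin 4) ℝ :=
  ((List.range k).map P).reverse.prod

theorem QQ_zero (P : ℕ → Matrix (Fin 4) (Fin 4) ℝ) : QQ P 0 = 1 := by simp [QQ]

theorem QQ_succ (P : ℕ → Matrix (Fin 4) (Fin 4) ℝ) (k : ℕ) : QQ P (k + 1) = P k * QQ P k := by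
  simp [QQ, List.range_succ]

theorem not_good (T : ℕ) (P : ℕ → Matrix (Fin 4) (Fin 4) ℝ)
    (hP : ∀ k < T, ∃ i j, i ≠ j ∧ P k = gossipM 4 i j) :
    ∀ k < T, ¬ Good (QQ P (k + 1)) := by
  intro k
  induction k with
  | zero =>
    intro hk
    obtain ⟨i, j, hij, h⟩ := hP 0 hk
    rw [QQ_succ, QQ_zero, h]
    exact good_base i j hij
  | succ k ih =>
    intro hk hG
    obtain ⟨i, j, hij, h⟩ := hP (k + 1) hk
    obtain ⟨e, f, hef, h'⟩ := hP k (by omega)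
    rw [QQ_succ, h] at hG
    refine ih (by omega) (good_step i j hij _ hG e f hef ?_)
    rw [QQ_succ, h']
    ext c
    rw [gossip_left e f hef, gossip_right e f hef]

theorem row_eq (P : ℕ → Matrix (Fin 4) (Fin 4) ℝ) (k : ℕ) (i j : Fin 4) (hij : i ≠ j)
    (h : P k = gossipM 4 i j) (c : Fin 4) : QQ P (k + 1) i c = QQ P (k + 1) j c := by
  rw [QQ_succ, h, gossip_left i j hij, gossip_right i j hij]

/-- Once the last three factors are known (`a c` the third from the end), finish. -/
theorem last_step (m : ℕ) (P : ℕ → Matrix (Fin 4) (Fin 4) ℝ)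
    (hP : ∀ k < m + 1, ∃ i j, i ≠ j ∧ P k = gossipM 4 i j)
    (hcons : ∀ k, k + 1 < m + 1 → P k ≠ P (k + 1))
    (a b c d : Fin 4) (hd : Dist4 a b c d) (v : Fin 4 → ℝ) (hv : v ≠ 0)
    (hm : P m = gossipM 4 a c)
    (ha : ∀ x, QQ P (m + 1) a x = 1 / 4 + v x) (hb : ∀ x, QQ P (m + 1) b x = 1 / 4 - v x)
    (hdd : ∀ x, QQ P (m + 1) d x = 1 / 4 - v x) :
    ∃ m', m = m' + 1 ∧ P m' = gossipM 4 b d := by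
  have hd' := hd
  obtain ⟨h1, h2, h3, h4, h5, h6⟩ := hd'
  have hb' : ∀ x, QQ P m b x = 1 / 4 - v x := fun x => by
    rw [← hb, QQ_succ, hm, gossip_other a c b h1.symm h4]
  have hd'' : ∀ x, QQ P m d x = 1 / 4 - v x := fun x => by
    rw [← hdd, QQ_succ, hm, gossip_other a c d h3.symm h6.symm]
  have hac : ∀ x, QQ P m a x + QQ P m c x = 1 / 2 + 2 * v x := fun x => by
    have := gossip_left a c h2 (QQ P m) x
    rw [← hm, ← QQ_succ, ha] at this
    linarith
  cases m with
  | zero =>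
    exfalso
    have e1 := hb' b
    have e2 := hd'' b
    rw [QQ_zero] at e1 e2
    simp [Matrix.one_apply, h5.symm] at e1 e2
    linarith
  | succ m' =>
    refine ⟨m', rfl, ?_⟩
    obtain ⟨i, j, hij, h⟩ := hP m' (by omega)
    have hng := not_good (m' + 2) P hP m' (by omega)
    have hrow := row_eq P m' i j hij h
    have hc := hcons m' (by omega)
    rw [hm, h] at hc
    have bad : ∀ (α γ : Fin 4), Dist4 α b γ d →
        (∀ x, QQ P (m' + 1) α x + QQ P (m' + 1) γ x = 1 / 2 + 2 * v x) →
        (∀ x, QQ P (m' + 1) α x = 1 / 4 - v x) → False := by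
      intro α γ hD hsum hα
      have hD' := hD
      obtain ⟨g1, g2, g3, g4, g5, g6⟩ := hD'
      apply hng
      refine ⟨fun x => 1 / 4 - v x, fun x => 4 * v x, Pi.single γ 1, ?_, ?_, ?_⟩
      · intro h0
        apply hv
        funext x
        have := congrFun h0 x
        simpa using this
      · intro e x
        have := hsum x
        rw [hα] at this
        rcases dist4_cover _ _ _ _ hD e with rfl | rfl | rfl | rfl
        · simp [g2, hα]
        · simp [g4, hb']
        · simp; linarith
        · simp [g6.symm, hd'']
      · simp
    have bada := bad a c hd hac
    have badc := bad c a ⟨h4.symm, h2.symm, h6, h1.symm, h5, h3⟩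
      (fun x => by rw [add_comm]; exact hac x)
    rcases dist4_cover _ _ _ _ hd i with rfl | rfl | rfl | rfl <;>
    rcases dist4_cover _ _ _ _ hd j with rfl | rfl | rfl | rfl <;>
    first
      | exact absurd rfl hij
      | exact h
      | exact h.trans (gossip_symm _ _)
      | exact absurd rfl hc
      | exact absurd (gossip_symm _ _) hc
      | exact (bada fun x => by rw [hrow, hb']).elim
      | exact (bada fun x => by rw [← hrow, hb']).elim
      | exact (bada fun x => by rw [hrow, hd'']).elim
      | exact (bada fun x => by rw [← hrow, hd'']).elim
      | exact (badc fun x => by rw [hrow, hb']).elim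
      | exact (badc fun x => by rw [← hrow, hb']).elim
      | exact (badc fun x => by rw [hrow, hd'']).elim
      | exact (badc fun x => by rw [← hrow, hd'']).elim

theorem stmt_6 (T : ℕ) (hT : 1 ≤ T) (P : ℕ → Matrix (Fin 4) (Fin 4) ℝ)
    (hmem : ∀ k < T, ∃ i j, P k = gossipM 4 i j)
    (hne1 : ∀ k < T, P k ≠ 1)
    (hconsec : ∀ k, k + 1 < T → P k ≠ P (k + 1))
    (hprod : ((List.range T).map P).reverse.prod = Matrix.of fun _ _ => (1 / 4 : ℝ))
    (hprev : ((List.range (T - 1)).map P).reverse.prod ≠ Matrix.of fun _ _ => (1 / 4 : ℝ)) :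
    4 ≤ T ∧ ∃ σ : Equiv.Perm (Fin 4),
      P (T - 1) = gossipM 4 (σ 0) (σ 1) ∧
      P (T - 2) = gossipM 4 (σ 2) (σ 3) ∧
      P (T - 3) = gossipM 4 (σ 0) (σ 2) ∧
      P (T - 4) = gossipM 4 (σ 1) (σ 3) := by
  have hP : ∀ k < T, ∃ i j, i ≠ j ∧ P k = gossipM 4 i j := by
    intro k hk
    obtain ⟨i, j, h⟩ := hmem k hk
    refine ⟨i, j, ?_, h⟩
    rintro rfl
    exact hne1 k hk (h.trans (gossip_self i))
  change QQ P T = _ at hprod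
  change QQ P (T - 1) ≠ _ at hprev
  obtain ⟨n, rfl⟩ : ∃ n, T = n + 1 := ⟨T - 1, by omega⟩
  simp only [Nat.add_sub_cancel] at hprev
  obtain ⟨a, b, hab, hPn⟩ := hP n (by omega)
  obtain ⟨c, d, hd⟩ := dist4_exists a b hab
  have hd' := hd
  obtain ⟨h1, h2, h3, h4, h5, h6⟩ := hd'
  have hJ : ∀ i x, (gossipM 4 a b * QQ P n) i x = 1 / 4 := fun i x => by
    rw [← hPn, ← QQ_succ, hprod]; rfl
  have rc : ∀ x, QQ P n c x = 1 / 4 := fun x => by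
    rw [← hJ c x, gossip_other a b c h2.symm h4.symm]
  have rd : ∀ x, QQ P n d x = 1 / 4 := fun x => by
    rw [← hJ d x, gossip_other a b d h3.symm h5.symm]
  obtain ⟨v, hva⟩ : ∃ v : Fin 4 → ℝ, ∀ x, QQ P n a x = 1 / 4 + v x :=
    ⟨fun x => QQ P n a x - 1 / 4, fun x => by ring⟩
  have hvb : ∀ x, QQ P n b x = 1 / 4 - v x := fun x => by
    have := gossip_left a b hab (QQ P n) x
    rw [hJ, hva] at this
    linarith
  have hv : v ≠ 0 := by
    rintro rfl
    apply hprev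
    ext i x
    rcases dist4_cover _ _ _ _ hd i with rfl | rfl | rfl | rfl
    · simp [hva]
    · simp [hvb]
    · simp [rc]
    · simp [rd]
  obtain ⟨x0, hx0⟩ := Function.ne_iff.mp hv
  simp only [Pi.zero_apply] at hx0
  cases n with
  | zero =>
    exfalso
    have := rc c
    rw [QQ_zero] at this
    norm_num at this
  | succ n =>
  obtain ⟨i, j, hij, hPi⟩ := hP n (by omega)
  have hrow := row_eq P n i j hij hPi x0
  have hPcd : P n = gossipM 4 c d := by
    rcases dist4_cover _ _ _ _ hd i with rfl | rfl | rfl | rfl <;>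
    rcases dist4_cover _ _ _ _ hd j with rfl | rfl | rfl | rfl <;>
    first
      | exact absurd rfl hij
      | exact hPi
      | exact hPi.trans (gossip_symm _ _)
      | (exfalso; apply hx0; simp only [hva, hvb, rc, rd] at hrow; linarith)
  clear hrow hPi hij
  have sa : ∀ x, QQ P n a x = 1 / 4 + v x := fun x => by
    rw [← hva, QQ_succ, hPcd, gossip_other c d a h2 h3]
  have sb : ∀ x, QQ P n b x = 1 / 4 - v x := fun x => by
    rw [← hvb, QQ_succ, hPcd, gossip_other c d b h4 h5]
  have scd : ∀ x, QQ P n c x + QQ P n d x = 1 / 2 := fun x => by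
    have := gossip_left c d h6 (QQ P n) x
    rw [← hPcd, ← QQ_succ, rc] at this
    linarith
  cases n with
  | zero =>
    exfalso
    have e1 := sa c
    have e2 := sb c
    rw [QQ_zero] at e1 e2
    simp [Matrix.one_apply, h2, h4] at e1 e2
    linarith
  | succ n =>
  obtain ⟨i, j, hij, hPi⟩ := hP n (by omega)
  have hrow := row_eq P n i j hij hPi
  have hcon := hconsec n (by omega)
  rw [hPcd, hPi] at hcon
  -- the finishing move, for any relabelling
  have fin : ∀ a' b' c' d' : Fin 4, Dist4 a' b' c' d' → ∀ u : Fin 4 → ℝ, u ≠ 0 →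
      P (n + 2) = gossipM 4 a' b' → P (n + 1) = gossipM 4 c' d' → P n = gossipM 4 a' c' →
      (∀ x, QQ P (n + 1) a' x = 1 / 4 + u x) → (∀ x, QQ P (n + 1) b' x = 1 / 4 - u x) →
      (∀ x, QQ P (n + 1) c' x + QQ P (n + 1) d' x = 1 / 2) →
      4 ≤ n + 1 + 1 + 1 ∧ ∃ σ : Equiv.Perm (Fin 4),
        P (n + 1 + 1 + 1 - 1) = gossipM 4 (σ 0) (σ 1) ∧
        P (n + 1 + 1 + 1 - 2) = gossipM 4 (σ 2) (σ 3) ∧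
        P (n + 1 + 1 + 1 - 3) = gossipM 4 (σ 0) (σ 2) ∧
        P (n + 1 + 1 + 1 - 4) = gossipM 4 (σ 1) (σ 3) := by
    intro a' b' c' d' hD u hu p1 p2 p3 ra rb rcd
    have hdd : ∀ x, QQ P (n + 1) d' x = 1 / 4 - u x := fun x => by
      have e1 := row_eq P n a' c' hD.2.1 p3 x
      have e2 := rcd x
      rw [← e1, ra] at e2
      linarith
    obtain ⟨m', rfl, hm'⟩ := last_step n P (fun k hk => hP k (by omega))
      (fun k hk => hconsec k (by omega)) a' b' c' d' hD u hu p3 ra rb hdd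
    obtain ⟨σ, s0, s1, s2, s3⟩ := dist4_perm a' b' c' d' hD
    refine ⟨by omega, σ, ?_⟩
    rw [s0, s1, s2, s3]
    exact ⟨p1, p2, p3, hm'⟩
  have hnv : -v ≠ 0 := neg_ne_zero.mpr hv
  have sa' : ∀ x, QQ P (n + 1) a x = 1 / 4 - (-v) x := fun x => by simp [sa]
  have sb' : ∀ x, QQ P (n + 1) b x = 1 / 4 + (-v) x := fun x => by
    rw [sb, Pi.neg_apply]; ring
  have sdc : ∀ x, QQ P (n + 1) d x + QQ P (n + 1) c x = 1 / 2 := fun x => by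
    rw [add_comm]; exact scd x
  have hPba := hPn.trans (gossip_symm a b)
  have hPdc := hPcd.trans (gossip_symm c d)
  have fac := fun h => fin a b c d hd v hv hPn hPcd h sa sb scd
  have fad := fun h => fin a b d c ⟨h1, h3, h2, h5, h4, h6.symm⟩ v hv hPn hPdc h sa sb sdc
  have fbc := fun h => fin b a c d ⟨h1.symm, h4, h5, h2, h3, h6⟩ (-v) hnv hPba hPcd h sb' sa' scd
  have fbd := fun h => fin b a d c ⟨h1.symm, h5, h4, h3, h2, h6.symm⟩ (-v) hnv hPba hPdc h
    sb' sa' sdc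
  have hrow0 := hrow x0
  rcases dist4_cover _ _ _ _ hd i with rfl | rfl | rfl | rfl <;>
  rcases dist4_cover _ _ _ _ hd j with rfl | rfl | rfl | rfl <;>
  first
    | exact absurd rfl hij
    | exact absurd rfl hcon
    | exact absurd (gossip_symm _ _) hcon
    | exact fac hPi
    | exact fac (hPi.trans (gossip_symm _ _))
    | exact fad hPi
    | exact fad (hPi.trans (gossip_symm _ _))
    | exact fbc hPi
    | exact fbc (hPi.trans (gossip_symm _ _))
    | exact fbd hPi
    | exact fbd (hPi.trans (gossip_symm _ _))
    | (exfalso; apply hx0; simp only [sa, sb] at hrow0; linarith)
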